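/- arXiv:2303.08413 — 2 statements merged into one kernel-verified Lean document; each statement's English description precedes it below -/
import Mathlib

section
/- Let R be a Hermite ring. Then R is an elementary divisor ring if and only if for every two unimodular pairs (a,b), (c,d) ∈ R² there exist t, d₁, d₂ ∈ R such that d + c·t = d₁·d₂ and the pairs (a,d₁) and (b,d₂) are unimodular. -/
/-- `R` is a *Hermite ring* (in the sense of Kaplansky) if every pair `(a, b)` can be
written as `a = r*s`, `b = r*t` with `(s, t)` unimodular. -/
def IsHermiteRing (R : Type*) [CommRing R] : Prop :=
  ∀ a b : R, ∃ r s t : R, a = r * s ∧ b = r * t ∧ ∃ x y : R, s * x + t * y = 1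

/-- `R` is an *elementary divisor ring* if every 2×2 matrix over `R` admits diagonal
reduction `M * A * N = diag(d₁, d₂)` with `M`, `N` invertible and `d₁ ∣ d₂`. -/
def IsEDR (R : Type*) [CommRing R] : Prop :=
  ∀ A : Matrix (Fin 2) (Fin 2) R, ∃ M N : Matrix (Fin 2) (Fin 2) R,
    IsUnit M.det ∧ IsUnit N.det ∧ ∃ d₁ d₂ : R, d₁ ∣ d₂ ∧
      M * A * N = Matrix.of ![![d₁, 0], ![0, d₂]]

/-- A pair of elements that lie in no common maximal ideal is unimodular. -/
theorem exists_mul_add_mul_eq_one_of_forall_isMaximal {R : Type*} [CommRing R] (x y : R)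
    (h : ∀ P : Ideal R, P.IsMaximal → x ∈ P → y ∈ P → False) :
    ∃ u v : R, x * u + y * v = 1 := by
  by_contra hne
  have htop : Ideal.span {x, y} ≠ ⊤ := by
    intro ht
    have h1 : (1 : R) ∈ Ideal.span {x, y} := ht ▸ Submodule.mem_top
    obtain ⟨u, v, huv⟩ := Ideal.mem_span_pair.mp h1
    exact hne ⟨u, v, by linear_combination huv⟩
  obtain ⟨P, hP, hle⟩ := Ideal.exists_le_maximal _ htop
  exact h P hP (hle (Ideal.subset_span (by simp))) (hle (Ideal.subset_span (by simp)))

/-- If `a, b, c, d₁, d₂` satisfy the coprimality relations witnessed by `e, e', f, f'`, and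
`(l₁, l₂)` is the primitive part of `(d₁, c * a * f)`, then any Bezout relation for `(l₁, l₂)`
gives a row whose product with `!![c * b, d₁ * d₂; 0, c * a]` is unimodular. -/
theorem unimodular_row_of_primitive_part {R : Type*} [CommRing R]
    {a b c d₁ d₂ e e' f f' g l₁ l₂ u₁ u₂ : R}
    (he : d₁ * e + c * a * e' = 1) (hf : d₂ * f + c * b * f' = 1)
    (hl₁ : d₁ = g * l₁) (hl₂ : c * a * f = g * l₂) (hu : l₁ * u₁ + l₂ * u₂ = 1) :
    ∃ x y : R, u₁ * (c * b) * x + (u₁ * (d₁ * d₂) + u₂ * (c * a)) * y = 1 := by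
  refine exists_mul_add_mul_eq_one_of_forall_isMaximal _ _ fun P hP hX hY => ?_
  let : Field (R ⧸ P) := Ideal.Quotient.field P
  have hX' := Ideal.Quotient.eq_zero_iff_mem.mpr hX
  have hY' := Ideal.Quotient.eq_zero_iff_mem.mpr hY
  replace he := congrArg (Ideal.Quotient.mk P) he
  replace hf := congrArg (Ideal.Quotient.mk P) hf
  replace hl₁ := congrArg (Ideal.Quotient.mk P) hl₁
  replace hl₂ := congrArg (Ideal.Quotient.mk P) hl₂
  replace hu := congrArg (Ideal.Quotient.mk P) hu
  simp only [map_mul, map_add, map_one] at hX' hY' he hf hl₁ hl₂ hu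
  generalize Ideal.Quotient.mk P a = a at *
  generalize Ideal.Quotient.mk P b = b at *
  generalize Ideal.Quotient.mk P c = c at *
  generalize Ideal.Quotient.mk P d₁ = d₁ at *
  generalize Ideal.Quotient.mk P d₂ = d₂ at *
  generalize Ideal.Quotient.mk P e = e at *
  generalize Ideal.Quotient.mk P e' = e' at *
  generalize Ideal.Quotient.mk P f = f at *
  generalize Ideal.Quotient.mk P f' = f' at *
  generalize Ideal.Quotient.mk P g = g at *
  generalize Ideal.Quotient.mk P l₁ = l₁ at *
  generalize Ideal.Quotient.mk P l₂ = l₂ at *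
  generalize Ideal.Quotient.mk P u₁ = u₁ at *
  generalize Ideal.Quotient.mk P u₂ = u₂ at *
  clear hX hY
  have hD : (c * a) * (c * b) = 0 := by
    linear_combination (l₁ * (c * a) - l₂ * (d₁ * d₂)) * hX' + l₂ * (c * b) * hY'
      - (c * a) * (c * b) * hu
  rcases mul_eq_zero.mp hD with h | h
  · have hd : d₁ ≠ 0 := by rintro rfl; simp [h] at he
    have hg : g ≠ 0 := by rintro rfl; simp at hl₁; exact hd hl₁
    have hl : l₂ = 0 := by
      have : g * l₂ = 0 := by rw [← hl₂, h, zero_mul]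
      exact (mul_eq_zero.mp this).resolve_left hg
    have hu₁ : u₁ ≠ 0 := by rintro rfl; simp [hl] at hu
    have hd₂ : d₂ = 0 := by simpa [h, hd, hu₁] using hY'
    have hcb : c * b = 0 := (mul_eq_zero.mp hX').resolve_left hu₁
    simp [hd₂, hcb] at hf
  · have hd : d₂ ≠ 0 := by rintro rfl; simp [h] at hf
    have hg : d₂ * g = 0 := by
      linear_combination hY' - u₁ * d₂ * hl₁ - u₂ * d₂ * hl₂ - d₂ * g * hu
        + u₂ * (c * a) * hf - u₂ * (c * a) * f' * h
    have hg : g = 0 := (mul_eq_zero.mp hg).resolve_left hd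
    have hd₁ : d₁ = 0 := by rw [hl₁, hg, zero_mul]
    have hcaf : c * a * f = 0 := by rw [hl₂, hg, zero_mul]
    have hf0 : f ≠ 0 := by rintro rfl; simp [h] at hf
    have hca : c * a = 0 := (mul_eq_zero.mp hcaf).resolve_right hf0
    simp [hd₁, hca] at he

/-- The factorization property makes the bilinear form of `!![c * b, d; 0, c * a]` represent `1`
whenever `(a, b)` and `(c, d)` are unimodular. -/
theorem IsHermiteRing.exists_bilinear_eq_one {R : Type*} [CommRing R] (hR : IsHermiteRing R)
    (hfac : ∀ a b c d : R, (∃ x y : R, a * x + b * y = 1) →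
      (∃ x y : R, c * x + d * y = 1) →
      ∃ t d₁ d₂ : R, d + c * t = d₁ * d₂ ∧
        (∃ x y : R, a * x + d₁ * y = 1) ∧ (∃ x y : R, b * x + d₂ * y = 1))
    {a b c d : R} (hab : ∃ x y : R, a * x + b * y = 1) (hcd : ∃ x y : R, c * x + d * y = 1) :
    ∃ p q x y : R, p * (c * b) * x + (p * d + q * (c * a)) * y = 1 := by
  obtain ⟨t, d₁, d₂, ht, ⟨z₁, z₂, hz⟩, ⟨w₁, w₂, hw⟩⟩ := hfac a b c d hab hcd
  obtain ⟨x₀, y₀, hxy⟩ := hab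
  obtain ⟨m, n, hmn⟩ := hcd
  have hc : IsCoprime (d₁ * d₂) c := ⟨n, m - t * n, by rw [← ht]; linear_combination hmn⟩
  have h₁ : IsCoprime d₁ (c * a) :=
    (IsCoprime.of_mul_left_left hc).mul_right ⟨z₂, z₁, by linear_combination hz⟩
  have h₂ : IsCoprime d₂ (c * b) :=
    (IsCoprime.of_mul_left_right hc).mul_right ⟨w₂, w₁, by linear_combination hw⟩
  obtain ⟨e, e', he⟩ := h₁
  obtain ⟨f, f', hf⟩ := h₂
  obtain ⟨g, l₁, l₂, hl₁, hl₂, u₁, u₂, hu⟩ := hR d₁ (c * a * f)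
  obtain ⟨x, y, h⟩ := unimodular_row_of_primitive_part (e := e) (e' := e') (f := f) (f' := f')
    (b := b) (d₂ := d₂) (by linear_combination he) (by linear_combination hf) hl₁ hl₂ hu
  exact ⟨u₁, u₂ + u₁ * t * x₀, x + t * y₀ * y, y, by
    linear_combination h + u₁ * y * ht + u₁ * c * t * y * hxy⟩

/-- A 2×2 matrix whose bilinear form represents `1` is equivalent to `diag(1, det A)`. -/
theorem exists_diagonal_of_bilinear_eq_one {R : Type*} [CommRing R] {α β γ δ p q x y : R}
    (h : (p * α + q * γ) * x + (p * β + q * δ) * y = 1) :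
    ∃ M N : Matrix (Fin 2) (Fin 2) R, IsUnit M.det ∧ IsUnit N.det ∧
      M * !![α, β; γ, δ] * N = !![1, 0; 0, α * δ - β * γ] := by
  refine ⟨!![p, q; -(γ * x + δ * y), α * x + β * y],
    !![x, -(p * β + q * δ); y, p * α + q * γ], ?_, ?_, ?_⟩
  · rw [Matrix.det_fin_two_of]
    convert isUnit_one using 1
    linear_combination h
  · rw [Matrix.det_fin_two_of]
    convert isUnit_one using 1
    linear_combination h
  · rw [Matrix.mul_fin_two, Matrix.mul_fin_two]
    ext i j
    fin_cases i <;> fin_cases j <;> simp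
    · linear_combination h
    · ring
    · ring
    · linear_combination (α * δ - β * γ) * h

/-- Over a Hermite ring every 2×2 matrix is, up to an invertible factor on the left, a multiple
of a triangular matrix `!![c * b, d; 0, c * a]` with `(a, b)` and `(c, d)` unimodular. -/
theorem IsHermiteRing.exists_triangular {R : Type*} [CommRing R] (hR : IsHermiteRing R)
    (A : Matrix (Fin 2) (Fin 2) R) :
    ∃ (M : Matrix (Fin 2) (Fin 2) R) (k a b c d : R), IsUnit M.det ∧
      (∃ x y : R, a * x + b * y = 1) ∧ (∃ x y : R, c * x + d * y = 1) ∧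
      M * A = k • !![c * b, d; 0, c * a] := by
  obtain ⟨r, s, t, hs, ht, x, y, hxy⟩ := hR (A 0 0) (A 1 0)
  obtain ⟨c₀, a, b, ha, hb, hab⟩ := hR (s * A 1 1 - t * A 0 1) r
  obtain ⟨k, c, d, hc, hd, hcd⟩ := hR c₀ (x * A 0 1 + y * A 1 1)
  refine ⟨!![x, y; -t, s], k, a, b, c, d, ?_, hab, hcd, ?_⟩
  · rw [Matrix.det_fin_two_of]
    convert isUnit_one using 1
    linear_combination hxy
  · rw [Matrix.eta_fin_two A, Matrix.mul_fin_two]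
    ext i j
    fin_cases i <;> fin_cases j <;> simp
    · linear_combination x * hs + y * ht + r * hxy + hb + b * hc
    · linear_combination hd
    · linear_combination s * ht - t * hs
    · linear_combination ha + a * hc

/-- Over an elementary divisor ring, the bilinear form of a 2×2 matrix whose entries have only
units as common divisors represents `1`. -/
theorem IsEDR.exists_bilinear_eq_one {R : Type*} [CommRing R] (hR : IsEDR R)
    (A : Matrix (Fin 2) (Fin 2) R) (hA : ∀ d : R, (∀ i j, d ∣ A i j) → IsUnit d) :
    ∃ p q x y : R, (p * A 0 0 + q * A 1 0) * x + (p * A 0 1 + q * A 1 1) * y = 1 := by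
  obtain ⟨M, N, hM, hN, d₁, d₂, hdvd, h⟩ := hR A
  have hA' : A = M⁻¹ * Matrix.of ![![d₁, 0], ![0, d₂]] * N⁻¹ := by
    rw [← h, Matrix.mul_assoc M, Matrix.nonsing_inv_mul_cancel_left _ _ hM,
      Matrix.mul_nonsing_inv_cancel_right _ _ hN]
  have hunit : IsUnit d₁ := by
    refine hA d₁ fun i j => ?_
    obtain ⟨k, rfl⟩ := hdvd
    refine ⟨(M⁻¹ * Matrix.of ![![1, 0], ![0, k]] * N⁻¹) i j, ?_⟩
    rw [hA']
    simp [Matrix.mul_apply, Fin.sum_univ_two]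
    ring
  obtain ⟨v, hv⟩ := hunit.exists_right_inv
  have h₀₀ := congrFun (congrFun h 0) 0
  simp [Matrix.mul_apply, Fin.sum_univ_two] at h₀₀
  exact ⟨M 0 0, M 0 1, N 0 0 * v, N 1 0 * v, by linear_combination v * h₀₀ + hv⟩

/-- A Hermite ring is an elementary divisor ring iff for all unimodular pairs
`(a, b)` and `(c, d)` there exists `t` with a factorization `d + c*t = d₁*d₂`
such that `(a, d₁)` and `(b, d₂)` are unimodular. -/
theorem hermite_edr_iff_factorization (R : Type*) [CommRing R] (hR : IsHermiteRing R) :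
    IsEDR R ↔ ∀ a b c d : R, (∃ x y : R, a * x + b * y = 1) →
      (∃ x y : R, c * x + d * y = 1) →
      ∃ t d₁ d₂ : R, d + c * t = d₁ * d₂ ∧
        (∃ x y : R, a * x + d₁ * y = 1) ∧ (∃ x y : R, b * x + d₂ * y = 1) := by
  constructor
  · rintro hE a b c d hab ⟨z, w, hzw⟩
    obtain ⟨m, n, hmn⟩ := hab
    obtain ⟨p, q, x, y, h⟩ := hE.exists_bilinear_eq_one !![c * b, w; 0, c * a] fun k hk => by
      have h₁ : k ∣ c * b := hk 0 0
      have h₂ : k ∣ w := hk 0 1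
      have h₃ : k ∣ c * a := hk 1 1
      refine isUnit_of_dvd_one ?_
      have : (1 : R) = c * a * (m * z) + c * b * (n * z) + w * d := by
        linear_combination -hzw - c * z * hmn
      rw [this]
      exact ((h₃.mul_right _).add (h₁.mul_right _)).add (h₂.mul_right _)
    simp at h
    refine ⟨p * y * z - (p * b * x + q * a * y) * d, p, y, ?_, ⟨c * q * y, c * b * x + w * y, ?_⟩,
      ⟨p * c * x, p * w + q * c * a, ?_⟩⟩
    · linear_combination p * y * hzw - d * h
    · linear_combination h
    · linear_combination h
  · intro hfac A
    obtain ⟨M, k, a, b, c, d, hM, hab, hcd, hMA⟩ := hR.exists_triangular A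
    obtain ⟨p, q, x, y, h⟩ := hR.exists_bilinear_eq_one hfac hab hcd
    obtain ⟨M', N, hM', hN, hred⟩ := exists_diagonal_of_bilinear_eq_one
      (α := c * b) (β := d) (γ := 0) (δ := c * a) (p := p) (q := q) (x := x) (y := y)
      (by linear_combination h)
    refine ⟨M' * M, N, ?_, hN, k, k * (c * b * (c * a)), dvd_mul_right _ _, ?_⟩
    · rw [Matrix.det_mul]
      exact hM'.mul hM
    · rw [Matrix.mul_assoc M', hMA, Matrix.mul_smul, Matrix.smul_mul, hred]
      ext i j
      fin_cases i <;> fin_cases j <;> simp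
end

section
/- Let R be a (WSU)₂ ring, i.e., for every unimodular A ∈ M₂(R) there exists an invertible N ∈ GL₂(R) such that A·N is a symmetric matrix. Then R is a WU₂ ring: for every (a,b,c) ∈ R³ with (a,b) unimodular, every square of a unit of R/(c) lies in the image of the map U(R/(a·c)) × U(R/(b·c)) → U(R/(c)) sending a pair of units (u,v) to the product of their images under the natural reduction maps. -/
/-- A 2×2 matrix over a commutative ring is *unimodular* if the ideal generated by
its entries is the whole ring, i.e. some linear combination of its entries is 1. -/
def MatUnimodular {R : Type*} [CommRing R] (A : Matrix (Fin 2) (Fin 2) R) : Prop :=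
  ∃ p q r s : R, p * A 0 0 + q * A 0 1 + r * A 1 0 + s * A 1 1 = 1

/-- A 2×2 matrix `A` is *extendable* if there is a 3×3 matrix of determinant 1 whose
upper-left 2×2 block is `A`. -/
def Extendable {R : Type*} [CommRing R] (A : Matrix (Fin 2) (Fin 2) R) : Prop :=
  ∃ B : Matrix (Fin 3) (Fin 3) R, B.det = 1 ∧
    ∀ i j : Fin 2, B i.castSucc j.castSucc = A i j

/-- A 2×2 matrix `A` is *simply extendable* if there is a 3×3 matrix of determinant 1
whose upper-left 2×2 block is `A` and whose (3,3) entry is 0. -/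
def SimplyExtendable {R : Type*} [CommRing R] (A : Matrix (Fin 2) (Fin 2) R) : Prop :=
  ∃ B : Matrix (Fin 3) (Fin 3) R, B.det = 1 ∧
    (∀ i j : Fin 2, B i.castSucc j.castSucc = A i j) ∧ B 2 2 = 0

/-- A 2×2 matrix is *non-full* if it is a product of a 2×1 matrix and a 1×2 matrix. -/
def NonFull {R : Type*} [CommRing R] (A : Matrix (Fin 2) (Fin 2) R) : Prop :=
  ∃ l m n q : R, A 0 0 = l * n ∧ A 0 1 = l * q ∧ A 1 0 = m * n ∧ A 1 1 = m * q

/-- An element with an inverse modulo `c` maps to a unit of `R/(c)`. -/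
theorem isUnit_mk_span_singleton {R : Type*} [CommRing R] {c u v k : R}
    (huv : u * v = 1 + c * k) : IsUnit (Ideal.Quotient.mk (Ideal.span {c}) u) := by
  refine IsUnit.of_mul_eq_one (Ideal.Quotient.mk (Ideal.span {c}) v) ?_
  rw [← map_mul, ← map_one (Ideal.Quotient.mk (Ideal.span {c})), Ideal.Quotient.eq,
    Ideal.mem_span_singleton]
  exact ⟨k, by linear_combination huv⟩

/-- A (WSU)₂ ring is a WU₂ ring: every square of a unit of `R/(c)` is a product of
images of units of `R/(ac)` and `R/(bc)` whenever `(a, b)` is unimodular. -/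
theorem wsu2_is_wu2 (R : Type*) [CommRing R]
    (h : ∀ A : Matrix (Fin 2) (Fin 2) R, MatUnimodular A →
      ∃ N : Matrix (Fin 2) (Fin 2) R, IsUnit N.det ∧ (A * N).transpose = A * N) :
    ∀ a b c : R, (∃ x y : R, a * x + b * y = 1) →
      ∀ w : R, IsUnit (Ideal.Quotient.mk (Ideal.span {c}) w) →
        ∃ u v : R, IsUnit (Ideal.Quotient.mk (Ideal.span {a * c}) u) ∧
          IsUnit (Ideal.Quotient.mk (Ideal.span {b * c}) v) ∧
          Ideal.Quotient.mk (Ideal.span {c}) (u * v) =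
            Ideal.Quotient.mk (Ideal.span {c}) (w * w) := by
  rintro a b c ⟨p, q, hpq⟩ w hw
  obtain ⟨w', d, hd⟩ : ∃ w' d : R, w * w' + c * d = 1 := by
    obtain ⟨z, hz⟩ := hw.exists_right_inv
    obtain ⟨w', rfl⟩ := Ideal.Quotient.mk_surjective z
    rw [← map_mul, ← map_one (Ideal.Quotient.mk (Ideal.span {c})), Ideal.Quotient.eq,
      Ideal.mem_span_singleton] at hz
    obtain ⟨k, hk⟩ := hz
    exact ⟨w', -k, by linear_combination hk⟩
  -- The matrix has rank one modulo each of `a * c` and `b * c`, though not over `R`.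
  obtain ⟨N, hdet, hsymm⟩ := h
    !![1 - a * p * c * d, a * p * w * c; a * p * c * w', a * p * c ^ 2]
    ⟨1, d * w', 0, d * d, by
      simp only [Matrix.of_apply, Matrix.cons_val', Matrix.cons_val_zero, Matrix.cons_val_one,
        Matrix.cons_val_fin_one]
      linear_combination (a * p * c * d) * hd⟩
  obtain ⟨μ', hμ⟩ := hdet.exists_right_inv
  rw [Matrix.det_fin_two] at hμ
  have hrel := congrFun (congrFun hsymm 1) 0
  simp only [Matrix.transpose_apply, Matrix.mul_apply, Fin.sum_univ_two, Matrix.of_apply,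
    Matrix.cons_val', Matrix.cons_val_zero, Matrix.cons_val_one,
    Matrix.cons_val_fin_one] at hrel
  generalize N 0 0 = x at *
  generalize N 0 1 = y at *
  generalize N 1 0 = z at *
  generalize N 1 1 = t at *
  obtain ⟨g, hg⟩ : ∃ g, g = w * t - d * y - w' * x - c * z := ⟨_, rfl⟩
  have hy : y = -(a * c * p * g) := by
    rw [hg]; linear_combination hrel
  have hE : w * (w' * y + c * t) - c * (w' * x + c * z) = b * q * c * g := by
    linear_combination y * hd - c * hg + hy - c * g * hpq
  refine ⟨μ' * x, w * (w * t - c * z) + d * (c * x - w * y), ?_, ?_, ?_⟩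
  · exact isUnit_mk_span_singleton (v := t) (k := -(p * g * z * μ')) (by
      linear_combination hμ + z * μ' * hy)
  · exact isUnit_mk_span_singleton
      (v := μ' * (w' * (w' * x + c * z) + d * (w' * y + c * t)))
      (k := μ' * q * g * (d * (w * t - d * y) - w' * (d * x - w * z))) (by
      linear_combination hμ + μ' * (d * (w * t - d * y) - w' * (d * x - w * z)) * hE
        + μ' * (x * t - y * z) * (1 + w * w' + c * d) * hd)
  · rw [Ideal.Quotient.eq, Ideal.mem_span_singleton]
    exact ⟨μ' * (-(w ^ 2 * a * p * g * z) + d * x ^ 2 - w * x * z + d * x * w * a * p * g), by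
      linear_combination w ^ 2 * hμ + μ' * (w ^ 2 * z - d * x * w) * hy⟩
end
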